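/- arXiv:math/9409206 — 3 statements merged into one kernel-verified Lean document; each statement's English description precedes it below -/
import Mathlib

section
/- For every n ≥ 1 and every ε ∈ 2^ω, if G is a connected B_n-free graph and G_ε is a subgraph of G, then G_ε = G (i.e. G has no vertices or edges outside G_ε). -/
open SimpleGraph

/-- `H` is isomorphic to a (not necessarily induced) subgraph of `G`:
    there is an injective graph homomorphism from `H` to `G`. -/
def IsSubgraphOf {V W : Type*} (H : SimpleGraph V) (G : SimpleGraph W) : Prop :=
  ∃ f : H →g G, Function.Injective f

/-- `G` is `F`-free: no subgraph of `G` (not necessarily induced) is isomorphic to `F`. -/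
def GraphFree {V W : Type*} (F : SimpleGraph V) (G : SimpleGraph W) : Prop :=
  ¬ IsSubgraphOf F G

/-- The `n`-bridge `B_n`. Vertices: `0 = a`, `1 = b`, `2 = c`,
    `3,…,n+2 = x₁,…,xₙ`, `n+3 = d`, `n+4 = e`.  Edges: `(a,c)`, `(b,c)`,
    `(c,x₁)`, `(xᵢ,xᵢ₊₁)` for `1 ≤ i < n`, `(xₙ,d)`, `(xₙ,e)`. -/
def Bridge (n : ℕ) : SimpleGraph (Fin (n + 5)) :=
  SimpleGraph.fromRel (fun u v =>
    ((u : ℕ) = 0 ∧ (v : ℕ) = 2) ∨ ((u : ℕ) = 1 ∧ (v : ℕ) = 2) ∨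
    (2 ≤ (u : ℕ) ∧ (u : ℕ) < n + 2 ∧ (v : ℕ) = (u : ℕ) + 1) ∨
    ((u : ℕ) = n + 2 ∧ (v : ℕ) = n + 3) ∨ ((u : ℕ) = n + 2 ∧ (v : ℕ) = n + 4))

/-- Core of a drive through (without its exits): the vertices of `K_{n+2}` and, for each
    of the `n` middle vertices, a copy of a dead end minus its top vertex `p_{n+1}`. -/
abbrev TCore (n : ℕ) := Fin (n + 2) ⊕ (Fin n × Fin (2 * n + 3))

/-- Vertex set of the graph `G_ε`:
    * `Sum.inl u`  — the dead end `D^ε` (vertices `0,…,2n+3`, where `0,…,n+2` is the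
      `K_{n+3}` with `k_{n+3} = p₀ = n+2`, and `2n+3 = p_{n+1}` is the left exit
      `l^ε(0)` of the first drive through);
    * `Sum.inr (Sum.inl (m, c))` — the core of the `m`-th drive through `T^ε(m)`;
    * `Sum.inr (Sum.inr ⟨m, c⟩)` — the `m`-th connecting path: the right exit
      `r^ε(m)` (`c = 0`), the interior of the highway `H^ε(m)` of length `n-1+ε(m)`,
      and the left exit `l^ε(m+1)` (`c = n + ε(m) - 1`); when `n = 1` and `ε(m) = 0`
      this path consists of a single vertex `r^ε(m) = l^ε(m+1)`, realizing the
      required identification. -/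
abbrev GV (n : ℕ) (ε : ℕ → Bool) :=
  Fin (2 * n + 4) ⊕ (ℕ × TCore n) ⊕ ((m : ℕ) × Fin (n + (ε m).toNat))

/-- Edges inside the core of a drive through: `K_{n+2}` is complete, each dead-end
    copy carries the dead-end edges, and the vertex `pₙ = 2n+2` of the `i`-th copy is
    joined to `k_{i+1}` (since `p_{n+1}` of that copy is identified with `k_{i+1}`). -/
def TRel (n : ℕ) : TCore n → TCore n → Prop
  | .inl u, .inl v => u ≠ v
  | .inr (i, x), .inr (i', y) => i = i' ∧
      (((x : ℕ) < n + 3 ∧ (y : ℕ) < n + 3 ∧ x ≠ y) ∨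
       (n + 2 ≤ (x : ℕ) ∧ (x : ℕ) < 2 * n + 2 ∧ (y : ℕ) = (x : ℕ) + 1))
  | .inr (i, x), .inl j => (x : ℕ) = 2 * n + 2 ∧ (j : ℕ) = (i : ℕ) + 1
  | _, _ => False

/-- The graph `G_ε`: the dead end `D^ε` whose `p_{n+1}` is the left exit `l^ε(0)`
    joined to `k₁` of `T^ε(0)`; the drive throughs `T^ε(m)`; and for each `m` the
    highway `H^ε(m)` of length `n - 1 + ε(m)` joining the right exit `r^ε(m)`
    (adjacent to `k_{n+2}` of `T^ε(m)`) to the left exit `l^ε(m+1)` (adjacent to `k₁`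
    of `T^ε(m+1)`), where `r^ε(m) = l^ε(m+1)` when `n = 1` and `ε(m) = 0`. -/
def GEps (n : ℕ) (ε : ℕ → Bool) : SimpleGraph (GV n ε) :=
  SimpleGraph.fromRel (fun a b =>
    match a, b with
    | .inl u, .inl v =>
        ((u : ℕ) < n + 3 ∧ (v : ℕ) < n + 3 ∧ u ≠ v) ∨
        (n + 2 ≤ (u : ℕ) ∧ (u : ℕ) < 2 * n + 3 ∧ (v : ℕ) = (u : ℕ) + 1)
    | .inl u, .inr (.inl (m, .inl j)) => (u : ℕ) = 2 * n + 3 ∧ m = 0 ∧ (j : ℕ) = 0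
    | .inr (.inl (m, c)), .inr (.inl (m', c')) => m = m' ∧ TRel n c c'
    | .inr (.inl (m, .inl j)), .inr (.inr ⟨m', c⟩) =>
        (j : ℕ) = n + 1 ∧ m' = m ∧ (c : ℕ) = 0
    | .inr (.inr ⟨m, c⟩), .inr (.inr ⟨m', c'⟩) => m' = m ∧ (c' : ℕ) = (c : ℕ) + 1
    | .inr (.inr ⟨m, c⟩), .inr (.inl (m', .inl j)) =>
        (c : ℕ) = n + (ε m).toNat - 1 ∧ m' = m + 1 ∧ (j : ℕ) = 0
    | _, _ => False)

/-- A path `x 0, …, x n` with two private extra neighbours at each end contains `B_n`. -/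
theorem bridge_isSubgraphOf {V : Type*} {G : SimpleGraph V} {n : ℕ} (x : ℕ → V)
    (hx : ∀ i ≤ n, ∀ j ≤ n, x i = x j → i = j) (hadj : ∀ j < n, G.Adj (x j) (x (j + 1)))
    {a b d e : V} (ha : G.Adj (x 0) a) (hb : G.Adj (x 0) b) (hd : G.Adj (x n) d)
    (he : G.Adj (x n) e) (hab : a ≠ b) (hde : d ≠ e) (had : a ≠ d) (hae : a ≠ e) (hbd : b ≠ d)
    (hbe : b ≠ e) (hleaf : ∀ j ≤ n, x j ≠ a ∧ x j ≠ b ∧ x j ≠ d ∧ x j ≠ e) :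
    IsSubgraphOf (Bridge n) G := by
  set g : ℕ → V := fun i => if i = 0 then a else if i = 1 then b else
    if i < n + 3 then x (i - 2) else if i = n + 3 then d else e with hg
  have g0 : g 0 = a := by simp [hg]
  have g1 : g 1 = b := by simp [hg]
  have gx : ∀ j ≤ n, g (j + 2) = x j := fun j hj => by
    simp [hg, show j + 2 < n + 3 by omega]
  have gd : g (n + 3) = d := by simp [hg]
  have ge : g (n + 4) = e := by simp [hg]
  have cases : ∀ i < n + 5, i = 0 ∨ i = 1 ∨ (∃ j ≤ n, i = j + 2) ∨ i = n + 3 ∨ i = n + 4 := by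
    intro i hi
    by_cases h : 2 ≤ i ∧ i ≤ n + 2
    · exact Or.inr (Or.inr (Or.inl ⟨i - 2, by omega, by omega⟩))
    · omega
  have inj : ∀ i < n + 5, ∀ j < n + 5, g i = g j → i = j := by
    intro i hi j hj h
    rcases cases i hi with rfl | rfl | ⟨i, hi, rfl⟩ | rfl | rfl <;>
    rcases cases j hj with rfl | rfl | ⟨j, hj, rfl⟩ | rfl | rfl <;>
    grind
  have adj : ∀ u v : ℕ, ((u = 0 ∧ v = 2) ∨ (u = 1 ∧ v = 2) ∨ (2 ≤ u ∧ u < n + 2 ∧ v = u + 1) ∨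
      (u = n + 2 ∧ v = n + 3) ∨ (u = n + 2 ∧ v = n + 4)) → G.Adj (g u) (g v) := by
    rintro u v (⟨rfl, rfl⟩ | ⟨rfl, rfl⟩ | ⟨h, h', rfl⟩ | ⟨rfl, rfl⟩ | ⟨rfl, rfl⟩)
    · rw [g0, gx 0 (Nat.zero_le n)]; exact ha.symm
    · rw [g1, gx 0 (Nat.zero_le n)]; exact hb.symm
    · obtain ⟨j, rfl⟩ := Nat.exists_eq_add_of_le' h
      rw [gx j (by omega), show j + 2 + 1 = (j + 1) + 2 by omega, gx (j + 1) (by omega)]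
      exact hadj j (by omega)
    · rw [gx n le_rfl, gd]; exact hd
    · rw [gx n le_rfl, ge]; exact he
  refine ⟨⟨fun i => g i, ?_⟩, fun i j h => Fin.ext (inj i i.2 j j.2 h)⟩
  intro u v huv
  rcases huv.2 with h | h
  · exact adj u v h
  · exact (adj v u h).symm

/-- The elements of a finite set can be listed starting from a prescribed one. -/
theorem Finset.exists_enum {V : Type*} (K : Finset V) {u : V} (hu : u ∈ K) :
    ∃ k : ℕ → V, k 0 = u ∧ (∀ i < K.card, ∀ j < K.card, k i = k j → i = j) ∧
      ∀ j < K.card, k j ∈ K := by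
  classical
  set l := u :: (K.erase u).toList with hl
  have hlen : l.length = K.card := by
    have := Finset.card_pos.2 ⟨u, hu⟩
    simp [hl, Finset.card_erase_of_mem hu]; omega
  have hnd : l.Nodup := by simp [hl, Finset.nodup_toList]
  refine ⟨fun j => l.getD j u, by simp [hl], ?_, ?_⟩
  · intro i hi j hj h
    rw [← hlen] at hi hj
    simp only [List.getD_eq_getElem, hi, hj] at h
    exact (hnd.getElem_inj_iff).1 h
  · intro j hj
    rw [← hlen] at hj
    simp only [List.getD_eq_getElem, hj]
    have hmem : ∀ v ∈ l, v ∈ K := by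
      intro v hv
      simp only [hl, List.mem_cons, Finset.mem_toList, Finset.mem_erase] at hv
      rcases hv with rfl | h
      · exact hu
      · exact h.2
    exact hmem _ (List.getElem_mem hj)

section Free

variable {V : Type*} {G : SimpleGraph V} {n : ℕ} {K : Finset V}

/-- In a `B_n`-free graph, a path of length `i ≤ n` leaving a large clique cannot end in a vertex
with two extra neighbours. -/
theorem GraphFree.false_of_tail (hG : GraphFree (Bridge n) G) (hK : G.IsClique K)
    {i : ℕ} (hi : i ≤ n) (hcard : n + 3 ≤ K.card + i) (q : ℕ → V) (hq0 : q 0 ∈ K)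
    (hq : ∀ j ≤ i, 1 ≤ j → q j ∉ K) (hinj : ∀ j ≤ i, ∀ k ≤ i, q j = q k → j = k)
    (hadj : ∀ j < i, G.Adj (q j) (q (j + 1))) {y z : V} (hyz : y ≠ z) (hy : G.Adj (q i) y)
    (hz : G.Adj (q i) z) (hyK : y ∉ K) (hzK : z ∉ K) (hyq : ∀ j ≤ i, q j ≠ y)
    (hzq : ∀ j ≤ i, q j ≠ z) : False := by
  obtain ⟨k, k0, kinj, kmem⟩ := K.exists_enum hq0
  have kadj : ∀ a < K.card, ∀ b < K.card, a ≠ b → G.Adj (k a) (k b) := fun a ha b hb hab =>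
    hK (kmem a ha) (kmem b hb) fun h => hab (kinj a ha b hb h)
  set x : ℕ → V := fun j => if j ≤ i then q (i - j) else k (j - i) with hx
  have xq : ∀ j ≤ i, x j = q (i - j) := fun j hj => by simp [hx, hj]
  have xk : ∀ j, i ≤ j → x j = k (j - i) := fun j hj => by
    rcases hj.eq_or_lt with rfl | h
    · simp [hx, k0]
    · simp [hx, h]
  have xne : ∀ j ≤ n, ∀ v, (∀ a ≤ i, q a ≠ v) → v ∉ K → x j ≠ v := by
    intro j hj v hv hvK
    rcases le_or_gt j i with h | h
    · rw [xq j h]; exact hv _ (by omega)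
    · rw [xk j h.le]; rintro rfl; exact hvK (kmem _ (by omega))
  have xnk : ∀ j ≤ n, ∀ a < K.card, n - i < a → x j ≠ k a := by
    intro j hj a ha hna h
    rcases lt_or_ge j i with h' | h'
    · rw [xq j h'.le] at h
      exact hq _ (by omega) (by omega) (h ▸ kmem a ha)
    · rw [xk j h'] at h
      have := kinj _ (by omega) _ ha h
      omega
  refine hG (bridge_isSubgraphOf x ?_ ?_ (a := y) (b := z) (d := k (n - i + 1))
    (e := k (n - i + 2)) ?_ ?_ ?_ ?_ hyz ?_ ?_ ?_ ?_ ?_ ?_)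
  · intro a ha b hb h
    rcases le_or_gt a i with h1 | h1 <;> rcases le_or_gt b i with h2 | h2
    · rw [xq a h1, xq b h2] at h
      have := hinj _ (by omega) _ (by omega) h
      omega
    · rw [xk b h2.le] at h
      rcases h1.eq_or_lt with rfl | h1
      · rw [xk a le_rfl] at h
        have := kinj _ (by omega) _ (by omega) h
        omega
      · rw [xq a h1.le] at h
        exact absurd (h ▸ kmem _ (by omega)) (hq (i - a) (by omega) (by omega))
    · rw [xk a h1.le] at h
      rcases h2.eq_or_lt with rfl | h2
      · rw [xk b le_rfl] at h
        have := kinj _ (by omega) _ (by omega) h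
        omega
      · rw [xq b h2.le] at h
        exact absurd (h ▸ kmem _ (by omega)) (hq (i - b) (by omega) (by omega))
    · rw [xk a h1.le, xk b h2.le] at h
      have := kinj _ (by omega) _ (by omega) h
      omega
  · intro j hj
    rcases lt_or_ge j i with h | h
    · rw [xq j h.le, xq (j + 1) h]
      have := hadj (i - (j + 1)) (by omega)
      rw [show i - (j + 1) + 1 = i - j by omega] at this
      exact this.symm
    · rw [xk j h, xk (j + 1) (by omega)]
      exact kadj _ (by omega) _ (by omega) (by omega)
  · rw [xq 0 (Nat.zero_le i)]; exact hy
  · rw [xq 0 (Nat.zero_le i)]; exact hz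
  · rw [xk n hi]; exact kadj _ (by omega) _ (by omega) (by omega)
  · rw [xk n hi]; exact kadj _ (by omega) _ (by omega) (by omega)
  · exact fun h => by have := kinj _ (by omega) _ (by omega) h; omega
  · rintro rfl; exact hyK (kmem _ (by omega))
  · rintro rfl; exact hyK (kmem _ (by omega))
  · rintro rfl; exact hzK (kmem _ (by omega))
  · rintro rfl; exact hzK (kmem _ (by omega))
  · exact fun j hj => ⟨xne j hj y hyq hyK, xne j hj z hzq hzK, xnk j hj _ (by omega) (by omega),
      xnk j hj _ (by omega) (by omega)⟩

/-- In a `B_n`-free graph, two vertices of a clique on `n + 2` vertices cannot have three distinct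
neighbours outside the clique between them, two at the first and one at the second. -/
theorem GraphFree.false_of_clique (hG : GraphFree (Bridge n) G) (hn : 1 ≤ n) (hK : G.IsClique K)
    (hcard : n + 2 ≤ K.card) {u v y z t : V} (hu : u ∈ K) (hv : v ∈ K) (huv : u ≠ v)
    (hy : G.Adj u y) (hz : G.Adj u z) (ht : G.Adj v t) (hyK : y ∉ K) (hzK : z ∉ K) (htK : t ∉ K)
    (hyz : y ≠ z) (hyt : y ≠ t) (hzt : z ≠ t) : False := by
  classical
  have hc := Finset.card_erase_of_mem hv
  obtain ⟨k, k0, kinj, kmem⟩ := (K.erase v).exists_enum (Finset.mem_erase.2 ⟨huv, hu⟩)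
  rw [hc] at kinj kmem
  simp only [Finset.mem_erase] at kmem
  have kK : ∀ j ≤ n, k j ∈ K := fun j hj => (kmem j (by omega)).2
  have kv : ∀ j ≤ n, k j ≠ v := fun j hj => (kmem j (by omega)).1
  replace kinj : ∀ i ≤ n, ∀ j ≤ n, k i = k j → i = j := fun i hi j hj =>
    kinj i (by omega) j (by omega)
  set x : ℕ → V := fun j => if j < n then k j else v with hx
  have xk : ∀ j < n, x j = k j := fun j hj => by simp [hx, hj]
  have xn : x n = v := by simp [hx]
  have xK : ∀ j ≤ n, x j ∈ K := fun j hj => by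
    rcases hj.lt_or_eq with h | rfl
    · rw [xk j h]; exact kK j hj
    · rwa [xn]
  have xinj : ∀ i ≤ n, ∀ j ≤ n, x i = x j → i = j := by
    intro a ha b hb h
    rcases ha.lt_or_eq with h1 | rfl <;> rcases hb.lt_or_eq with h2 | rfl
    · rw [xk a h1, xk b h2] at h; exact kinj a ha b hb h
    · rw [xk a h1, xn] at h; exact absurd h (kv a ha)
    · rw [xk b h2, xn] at h; exact absurd h.symm (kv b hb)
    · rfl
  have ne : ∀ {a b : V}, a ∈ K → b ∉ K → a ≠ b := by
    rintro a b ha hb rfl; exact hb ha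
  refine hG (bridge_isSubgraphOf x xinj ?_ (a := y) (b := z) (d := t) (e := k n) ?_ ?_ ?_ ?_ hyz
    (ne (kK n le_rfl) htK).symm hyt (ne (kK n le_rfl) hyK).symm hzt (ne (kK n le_rfl) hzK).symm ?_)
  · exact fun j hj => hK (xK _ hj.le) (xK _ hj) fun h => by
      have := xinj _ hj.le _ hj h; omega
  · rwa [xk 0 (by omega), k0]
  · rwa [xk 0 (by omega), k0]
  · rwa [xn]
  · rw [xn]; exact hK hv (kK n le_rfl) (kv n le_rfl).symm
  · refine fun j hj => ⟨ne (xK j hj) hyK, ne (xK j hj) hzK, ne (xK j hj) htK, ?_⟩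
    rcases hj.lt_or_eq with h | rfl
    · rw [xk j h]; exact fun h' => by have := kinj j hj n le_rfl h'; omega
    · rw [xn]; exact (kv _ le_rfl).symm

/-- In a `B_n`-free graph, an interior vertex of a path leaving a clique on `n + 2` vertices, at
distance at most `n` from it, has no neighbours outside the clique but its two path neighbours. -/
theorem GraphFree.eq_of_adj_spine (hG : GraphFree (Bridge n) G) (hK : G.IsClique K)
    (hcard : n + 2 ≤ K.card) (s : ℕ → V) {i : ℕ} (hi : i ≤ n) (h1 : 1 ≤ i) (hs0 : s 0 ∈ K)
    (hs : ∀ j ≤ i + 1, 1 ≤ j → s j ∉ K)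
    (hinj : ∀ j ≤ i + 1, ∀ k ≤ i + 1, s j = s k → j = k)
    (hadj : ∀ j ≤ i, G.Adj (s j) (s (j + 1))) {w : V} (hw : G.Adj (s i) w) (hwK : w ∉ K) :
    w = s (i - 1) ∨ w = s (i + 1) := by
  by_contra! hne
  have hsucc : ∀ j ≤ i, s j ≠ s (i + 1) := fun j hj h => by
    have := hinj j (by omega) (i + 1) le_rfl h; omega
  by_cases hex : ∃ j ≤ i, s j = w
  · obtain ⟨j, hj, rfl⟩ := hex
    have hj0 : j ≠ 0 := by rintro rfl; exact hwK hs0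
    have hji : j ≠ i := by rintro rfl; exact hw.ne rfl
    have hji' : j ≠ i - 1 := by rintro rfl; exact hne.1 rfl
    set q : ℕ → V := fun a => if a ≤ j then s a else s i with hqd
    have q1 : ∀ a ≤ j, q a = s a := fun a ha => by simp [hqd, ha]
    have q2 : q (j + 1) = s i := by simp [hqd]
    have hprev := hadj (i - 1) (by omega)
    rw [show i - 1 + 1 = i by omega] at hprev
    have qs : ∀ a ≤ j + 1, ∃ b ≤ i, q a = s b ∧ b ≠ i - 1 ∧ (a ≤ j → b = a) ∧
        (j < a → b = i) := by
      intro a ha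
      rcases Nat.lt_or_ge j a with h | h
      · obtain rfl : a = j + 1 := by omega
        exact ⟨i, le_rfl, q2, by omega, by omega, fun _ => rfl⟩
      · exact ⟨a, by omega, q1 a h, by omega, fun _ => rfl, by omega⟩
    refine hG.false_of_tail hK (i := j + 1) (by omega) (by omega) q
      (by rw [q1 0 (Nat.zero_le j)]; exact hs0) ?_ ?_ ?_ (hsucc (i - 1) (by omega))
      (by rw [q2]; exact hprev.symm) (by rw [q2]; exact hadj i le_rfl)
      (hs _ (by omega) (by omega)) (hs _ le_rfl (by omega)) ?_ ?_
    · intro a ha ha1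
      obtain ⟨b, hb, hqb, -, hb1, hb2⟩ := qs a ha
      rw [hqb]; exact hs b (by omega) (by omega)
    · intro a ha b hb h
      obtain ⟨a', ha', hqa, -, ha1, ha2⟩ := qs a ha
      obtain ⟨b', hb', hqb, -, hb1, hb2⟩ := qs b hb
      rw [hqa, hqb] at h
      have := hinj _ (by omega) _ (by omega) h
      omega
    · intro a ha
      rcases (Nat.lt_succ_iff.1 ha).lt_or_eq with h | rfl
      · rw [q1 a h.le, q1 (a + 1) h]; exact hadj a (by omega)
      · rw [q1 a le_rfl, q2]; exact hw.symm
    · intro a ha h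
      obtain ⟨b, hb, hqb, hb', -, -⟩ := qs a ha
      rw [hqb] at h
      exact hb' (hinj _ (by omega) _ (by omega) h)
    · intro a ha
      obtain ⟨b, hb, hqb, -, -, -⟩ := qs a ha
      rw [hqb]; exact hsucc b hb
  · push Not at hex
    exact hG.false_of_tail hK hi (by omega) s hs0 (fun j hj => hs j (by omega))
      (fun j hj k hk => hinj j (by omega) k (by omega)) (fun j hj => hadj j hj.le) hne.2.symm
      (hadj i le_rfl) hw (hs _ le_rfl (by omega)) hwK hsucc hex

/-- In a `B_n`-free graph, the only edge leaving the clique of a dead end is the one starting its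
path. -/
theorem GraphFree.eq_of_adj_deadEnd (hG : GraphFree (Bridge n) G) (hn : 1 ≤ n)
    (hK : G.IsClique K) (hcard : n + 3 ≤ K.card) {p₀ p₁ p₂ : V} (h0 : p₀ ∈ K) (h1 : p₁ ∉ K)
    (h2 : p₂ ∉ K) (h01 : G.Adj p₀ p₁) (h12 : G.Adj p₁ p₂) {u w : V} (hu : u ∈ K) (hw : w ∉ K)
    (huw : G.Adj u w) : u = p₀ ∧ w = p₁ := by
  classical
  by_cases hup : u = p₀
  · subst hup
    refine ⟨rfl, ?_⟩
    by_contra hne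
    refine hG.false_of_tail hK (i := 0) (by omega) (by omega) (fun _ => u) hu
      (fun j hj hj' => by omega) (fun j hj k hk _ => by omega) (fun j hj => by omega) hne huw h01
      hw h1 ?_ ?_
    · rintro - - rfl; exact hw hu
    · rintro - - rfl; exact h1 hu
  exfalso
  by_cases hwp : w = p₁
  · subst hwp
    have hc := Finset.card_erase_of_mem h0
    refine hG.false_of_tail (K := K.erase p₀)
      (hK.subset (Finset.coe_subset.2 (Finset.erase_subset _ _))) (i := 1) hn
      (by omega) (fun j => if j = 0 then u else w) (by simp [hup, hu]) ?_ ?_ ?_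
      (y := p₀) (z := p₂) ?_ ?_ ?_ ?_ ?_ ?_ ?_
    · intro j hj hj'
      simp [show j ≠ 0 by omega, hw]
    · intro j hj k hk
      have := huw.ne
      have := huw.ne'
      by_cases hj0 : j = 0 <;> by_cases hk0 : k = 0 <;> simp [hj0, hk0] <;> first | omega | tauto
    · intro j hj
      obtain rfl : j = 0 := by omega
      simpa using huw
    · rintro rfl; exact h2 h0
    · simpa using h01.symm
    · simpa using h12
    · simp
    · simp [h2]
    · intro j hj
      by_cases hj0 : j = 0
      · simpa [hj0] using hup
      · simpa [hj0] using h01.ne'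
    · intro j hj
      by_cases hj0 : j = 0
      · simp only [hj0, if_true]; rintro rfl; exact h2 hu
      · simpa [hj0] using h12.ne
  · obtain ⟨x, hx⟩ : ((K.erase u).erase p₀).Nonempty := by
      rw [← Finset.card_pos, Finset.card_erase_of_mem (Finset.mem_erase.2 ⟨Ne.symm hup, h0⟩),
        Finset.card_erase_of_mem hu]
      omega
    simp only [Finset.mem_erase] at hx
    obtain ⟨hx0, hxu, hxK⟩ := hx
    have hc := Finset.card_erase_of_mem hxK
    refine hG.false_of_clique (K := K.erase x) hn
      (hK.subset (Finset.coe_subset.2 (Finset.erase_subset _ _))) (by omega)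
      (Finset.mem_erase.2 ⟨Ne.symm hxu, hu⟩) (Finset.mem_erase.2 ⟨Ne.symm hx0, h0⟩) hup huw
      (hK hu hxK (Ne.symm hxu)) h01 (by simp [hw]) (by simp) (by simp [h1]) ?_ hwp ?_
    · rintro rfl; exact hw hxK
    · rintro rfl; exact h1 hxK

/-- In a `B_n`-free graph, if the vertices `k i` of a clique on `n + 2` vertices have distinct
neighbours `o i` outside it, then no further edges leave the clique. -/
theorem GraphFree.eq_of_adj_driveThrough (hG : GraphFree (Bridge n) G) (hn : 1 ≤ n)
    (hK : G.IsClique K) (hcard : n + 2 ≤ K.card) (k o : ℕ → V) (hk : ∀ u ∈ K, ∃ i < n + 2, k i = u)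
    (ho : ∀ i < n + 2, G.Adj (k i) (o i)) (hoK : ∀ i < n + 2, o i ∉ K)
    (hinj : ∀ i < n + 2, ∀ j < n + 2, o i = o j → i = j) {i : ℕ} (hi : i < n + 2) (hiK : k i ∈ K)
    {w : V} (hw : w ∉ K) (huw : G.Adj (k i) w) : w = o i := by
  classical
  by_contra hne
  have hc := Finset.card_erase_of_mem hiK
  obtain ⟨a, ha, b, hb, hab⟩ := Finset.one_lt_card.1 (show 1 < (K.erase (k i)).card by omega)
  simp only [Finset.mem_erase] at ha hb
  obtain ⟨a, ha', rfl⟩ := hk _ ha.2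
  obtain ⟨b, hb', rfl⟩ := hk _ hb.2
  have key : ∀ j < n + 2, k j ∈ K → k j ≠ k i → o j = w := by
    intro j hj hjK hji
    by_contra h
    refine hG.false_of_clique hn hK hcard hiK hjK (Ne.symm hji) huw (ho i hi) (ho j hj) hw
      (hoK i hi) (hoK j hj) hne (Ne.symm h) fun h' => hji ?_
    rw [hinj i hi j hj h']
  have := hinj a ha' b hb' ((key a ha' ha.2 ha.1).trans (key b hb' hb.2 hb.1).symm)
  exact hab (by rw [this])

end Free

section Closed

variable {V W : Type*} {G : SimpleGraph V} {H : SimpleGraph W} {n : ℕ}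

/-- All `G`-neighbours of the image of `u` come from `H`-neighbours of `u`. -/
def NeighborClosed (f : H →g G) (u : W) : Prop :=
  ∀ w, G.Adj (f u) w → ∃ v, H.Adj u v ∧ f v = w

variable {f : H →g G}

theorem NeighborClosed.adj (hf : Function.Injective f) {u v : W} (hu : NeighborClosed f u)
    (h : G.Adj (f u) (f v)) : H.Adj u v := by
  obtain ⟨v', h', he⟩ := hu _ h
  rwa [← hf he]

theorem surjective_of_neighborClosed [Nonempty W] (hconn : G.Connected)
    (h : ∀ u, NeighborClosed f u) : Function.Surjective f := by
  have key : ∀ x y : V, G.Walk x y → x ∈ Set.range f → y ∈ Set.range f := by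
    intro x y p
    induction p with
    | nil => exact id
    | cons hxy _ ih =>
      rintro ⟨u, rfl⟩
      obtain ⟨v, -, rfl⟩ := h u _ hxy
      exact ih ⟨v, rfl⟩
  intro y
  obtain ⟨p⟩ := hconn.preconnected (f (Classical.arbitrary W)) y
  exact key _ _ p ⟨_, rfl⟩

/-- The image under `f` of the first `N` values of `k`. -/
def imageFinset (hf : Function.Injective f) (k : ℕ → W) (N : ℕ)
    (hk : ∀ i < N, ∀ j < N, k i = k j → i = j) : Finset V :=
  (Finset.univ : Finset (Fin N)).map
    ⟨fun i : Fin N => f (k i), fun (i j : Fin N) h => Fin.ext (hk i i.2 j j.2 (hf h))⟩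

variable {hf : Function.Injective f} {k : ℕ → W} {N : ℕ}
  {hk : ∀ i < N, ∀ j < N, k i = k j → i = j}

theorem card_imageFinset : (imageFinset hf k N hk).card = N := by simp [imageFinset]

theorem mem_imageFinset {w : V} : w ∈ imageFinset hf k N hk ↔ ∃ i < N, f (k i) = w := by
  simp only [imageFinset, Finset.mem_map, Finset.mem_univ, true_and]
  exact ⟨fun ⟨i, h⟩ => ⟨i, i.2, h⟩, fun ⟨i, hi, h⟩ => ⟨⟨i, hi⟩, h⟩⟩

theorem apply_notMem_imageFinset {v : W} (h : ∀ i < N, k i ≠ v) :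
    f v ∉ imageFinset hf k N hk := by
  rw [mem_imageFinset]
  rintro ⟨i, hi, he⟩
  exact h i hi (hf he)

theorem isClique_imageFinset (h : ∀ i < N, ∀ j < N, i ≠ j → H.Adj (k i) (k j)) :
    G.IsClique (imageFinset hf k N hk) := by
  intro x hx y hy hxy
  obtain ⟨i, hi, rfl⟩ := mem_imageFinset.1 (Finset.mem_coe.1 hx)
  obtain ⟨j, hj, rfl⟩ := mem_imageFinset.1 (Finset.mem_coe.1 hy)
  exact f.map_adj (h i hi j hj fun e => hxy (by rw [e]))

theorem neighborClosed_of_spine (hf : Function.Injective f)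
    (hk : ∀ i < N, ∀ j < N, k i = k j → i = j) (hG : GraphFree (Bridge n) G) (hN : n + 2 ≤ N)
    (hadj : ∀ i < N, ∀ j < N, i ≠ j → H.Adj (k i) (k j)) (hcl : ∀ i < N, NeighborClosed f (k i))
    (s : ℕ → W) {i : ℕ} (hi : i ≤ n) (h1 : 1 ≤ i) {a : ℕ} (ha : a < N) (hs0 : s 0 = k a)
    (hs : ∀ j ≤ i + 1, 1 ≤ j → ∀ b < N, k b ≠ s j)
    (hinj : ∀ j ≤ i + 1, ∀ k ≤ i + 1, s j = s k → j = k)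
    (hsadj : ∀ j ≤ i, H.Adj (s j) (s (j + 1))) : NeighborClosed f (s i) := by
  intro w hw
  by_cases hwK : w ∈ imageFinset hf k N hk
  · obtain ⟨b, hb, rfl⟩ := mem_imageFinset.1 hwK
    exact ⟨_, ((hcl b hb).adj hf hw.symm).symm, rfl⟩
  · have := hG.eq_of_adj_spine (isClique_imageFinset (hf := hf) (hk := hk) hadj) (by rw [card_imageFinset]; exact hN)
      (fun j => f (s j)) hi h1 (by rw [hs0]; exact mem_imageFinset.2 ⟨a, ha, rfl⟩)
      (fun j hj hj1 => apply_notMem_imageFinset (hs j hj hj1))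
      (fun j hj k hk h => hinj j hj k hk (hf h)) (fun j hj => f.map_adj (hsadj j hj)) hw hwK
    rcases this with rfl | rfl
    · have := hsadj (i - 1) (by omega)
      rw [show i - 1 + 1 = i by omega] at this
      exact ⟨_, this.symm, rfl⟩
    · exact ⟨_, hsadj i le_rfl, rfl⟩

theorem neighborClosed_of_deadEnd (hf : Function.Injective f)
    (hk : ∀ i < N, ∀ j < N, k i = k j → i = j) (hG : GraphFree (Bridge n) G)
    (hn : 1 ≤ n) (hN : N = n + 3)
    (hadj : ∀ i < N, ∀ j < N, i ≠ j → H.Adj (k i) (k j))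
    (p : ℕ → W) {a : ℕ} (ha : a < N) (hp0 : p 0 = k a)
    (hp : ∀ j ≤ n + 1, 1 ≤ j → ∀ b < N, k b ≠ p j)
    (hinj : ∀ j ≤ n + 1, ∀ k ≤ n + 1, p j = p k → j = k)
    (hpadj : ∀ j ≤ n, H.Adj (p j) (p (j + 1))) :
    (∀ i < N, NeighborClosed f (k i)) ∧ ∀ i ≤ n, 1 ≤ i → NeighborClosed f (p i) := by
  have hcl : ∀ i < N, NeighborClosed f (k i) := by
    intro i hi w hw
    by_cases hwK : w ∈ imageFinset hf k N hk
    · obtain ⟨b, hb, rfl⟩ := mem_imageFinset.1 hwK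
      exact ⟨_, hadj i hi b hb (by rintro rfl; exact hw.ne rfl), rfl⟩
    · obtain ⟨hu, rfl⟩ := hG.eq_of_adj_deadEnd hn (isClique_imageFinset (hf := hf) (hk := hk) hadj)
        (by rw [card_imageFinset, hN]) (p₀ := f (p 0)) (p₁ := f (p 1)) (p₂ := f (p 2))
        (by rw [hp0]; exact mem_imageFinset.2 ⟨a, ha, rfl⟩)
        (apply_notMem_imageFinset (hp 1 (by omega) (by omega)))
        (apply_notMem_imageFinset (hp 2 (by omega) (by omega)))
        (f.map_adj (hpadj 0 (by omega))) (f.map_adj (hpadj 1 hn))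
        (mem_imageFinset.2 ⟨i, hi, rfl⟩) hwK hw
      rw [hf hu]
      exact ⟨_, hpadj 0 (by omega), rfl⟩
  refine ⟨hcl, fun i hi h1 => ?_⟩
  exact neighborClosed_of_spine hf hk hG (by omega) hadj hcl p hi h1 ha hp0
    (fun j hj => hp j (by omega)) (fun j hj k hk => hinj j (by omega) k (by omega))
    (fun j hj => hpadj j (by omega))

theorem neighborClosed_of_driveThrough (hf : Function.Injective f)
    (hk : ∀ i < N, ∀ j < N, k i = k j → i = j) (hG : GraphFree (Bridge n) G)
    (hn : 1 ≤ n) (hN : N = n + 2)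
    (hadj : ∀ i < N, ∀ j < N, i ≠ j → H.Adj (k i) (k j)) (o : ℕ → W)
    (ho : ∀ i < N, H.Adj (k i) (o i)) (hok : ∀ i < N, ∀ j < N, k j ≠ o i)
    (hinj : ∀ i < N, ∀ j < N, o i = o j → i = j) {i : ℕ} (hi : i < N) :
    NeighborClosed f (k i) := by
  intro w hw
  by_cases hwK : w ∈ imageFinset hf k N hk
  · obtain ⟨b, hb, rfl⟩ := mem_imageFinset.1 hwK
    exact ⟨_, hadj i hi b hb (by rintro rfl; exact hw.ne rfl), rfl⟩
  · subst hN
    have := hG.eq_of_adj_driveThrough hn (isClique_imageFinset (hf := hf) (hk := hk) hadj) (card_imageFinset.ge)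
      (fun j => f (k j)) (fun j => f (o j)) (fun u hu => mem_imageFinset.1 hu)
      (fun j hj => f.map_adj (ho j hj)) (fun j hj => apply_notMem_imageFinset (hok j hj))
      (fun a ha b hb h => hinj a ha b hb (hf h)) hi (mem_imageFinset.2 ⟨i, hi, rfl⟩) hwK hw
    exact ⟨_, ho i hi, this.symm⟩

end Closed

namespace GEps

variable {n : ℕ} {ε : ℕ → Bool}

/-- The `j`-th vertex of the dead end `D^ε`. -/
def dVert (n : ℕ) (ε : ℕ → Bool) (j : ℕ) : GV n ε := .inl ⟨min j (2 * n + 3), by omega⟩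

/-- The `j`-th vertex of the complete graph of the `m`-th drive through. -/
def cVert (n : ℕ) (ε : ℕ → Bool) (m j : ℕ) : GV n ε :=
  .inr (.inl (m, .inl ⟨min j (n + 1), by omega⟩))

/-- The `x`-th vertex of the `i`-th dead end of the `m`-th drive through. -/
def eVert (hn : 1 ≤ n) (ε : ℕ → Bool) (m i x : ℕ) : GV n ε :=
  .inr (.inl (m, .inr (⟨min i (n - 1), by omega⟩, ⟨min x (2 * n + 2), by omega⟩)))

/-- The `c`-th vertex of the `m`-th highway. -/
def hVert (hn : 1 ≤ n) (ε : ℕ → Bool) (m c : ℕ) : GV n ε :=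
  .inr (.inr ⟨m, ⟨min c (n + (ε m).toNat - 1), by omega⟩⟩)

/-- The left exit of the `m`-th drive through. -/
def leftExit (hn : 1 ≤ n) (ε : ℕ → Bool) : ℕ → GV n ε
  | 0 => dVert n ε (2 * n + 3)
  | m + 1 => hVert hn ε m (n + (ε m).toNat - 1)

variable {hn : 1 ≤ n} {m m' i i' j j' x x' c c' : ℕ}

theorem dVert_inj : dVert n ε j = dVert n ε j' ↔ min j (2 * n + 3) = min j' (2 * n + 3) := by
  simp [dVert]

theorem cVert_inj :
    cVert n ε m j = cVert n ε m' j' ↔ m = m' ∧ min j (n + 1) = min j' (n + 1) := by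
  simp [cVert]

theorem eVert_inj : eVert hn ε m i x = eVert hn ε m' i' x' ↔
    m = m' ∧ min i (n - 1) = min i' (n - 1) ∧ min x (2 * n + 2) = min x' (2 * n + 2) := by
  simp [eVert]

theorem hVert_inj : hVert hn ε m c = hVert hn ε m' c' ↔
    m = m' ∧ min c (n + (ε m).toNat - 1) = min c' (n + (ε m).toNat - 1) := by
  unfold hVert
  constructor
  · intro h
    simp only [Sum.inr.injEq, Sigma.mk.injEq] at h
    obtain ⟨rfl, h⟩ := h
    simpa using h
  · rintro ⟨rfl, h⟩
    simpa using h

theorem dVert_ne_cVert : dVert n ε j ≠ cVert n ε m j' := by simp [dVert, cVert]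
theorem dVert_ne_hVert : dVert n ε j ≠ hVert hn ε m c := by simp [dVert, hVert]
theorem dVert_ne_eVert : dVert n ε j ≠ eVert hn ε m i x := by simp [dVert, eVert]
theorem cVert_ne_eVert : cVert n ε m j ≠ eVert hn ε m' i x := by simp [cVert, eVert]
theorem cVert_ne_hVert : cVert n ε m j ≠ hVert hn ε m' c := by simp [cVert, hVert]
theorem eVert_ne_hVert : eVert hn ε m i x ≠ hVert hn ε m' c := by simp [eVert, hVert]

theorem leftExit_ne_cVert : leftExit hn ε m ≠ cVert n ε m' j := by
  cases m
  · exact dVert_ne_cVert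
  · exact (cVert_ne_hVert (hn := hn)).symm

theorem leftExit_ne_eVert : leftExit hn ε m ≠ eVert hn ε m' i x := by
  cases m
  · exact dVert_ne_eVert
  · exact eVert_ne_hVert.symm

theorem leftExit_ne_hVert : leftExit hn ε m ≠ hVert hn ε m c := by
  cases m
  · exact dVert_ne_hVert
  · simp [leftExit, hVert_inj]

theorem adj_dVert (hj : j < n + 3) (hj' : j' < n + 3) (h : j ≠ j') :
    (GEps n ε).Adj (dVert n ε j) (dVert n ε j') := by
  refine ⟨by rw [Ne, dVert_inj]; omega, Or.inl ?_⟩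
  simp only [dVert, Ne, Fin.mk.injEq]
  omega

theorem adj_dVert_succ (h : n + 2 ≤ j) (h' : j < 2 * n + 3) :
    (GEps n ε).Adj (dVert n ε j) (dVert n ε (j + 1)) := by
  refine ⟨by rw [Ne, dVert_inj]; omega, Or.inl ?_⟩
  simp only [dVert, Ne, Fin.mk.injEq]
  omega

theorem adj_cVert (hj : j < n + 2) (hj' : j' < n + 2) (h : j ≠ j') :
    (GEps n ε).Adj (cVert n ε m j) (cVert n ε m j') := by
  refine ⟨by rw [Ne, cVert_inj]; omega, Or.inl ?_⟩
  simp only [cVert, TRel, Ne, Fin.mk.injEq, true_and]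
  omega

theorem adj_eVert (hx : x < n + 3) (hx' : x' < n + 3) (h : x ≠ x') :
    (GEps n ε).Adj (eVert hn ε m i x) (eVert hn ε m i x') := by
  refine ⟨by rw [Ne, eVert_inj]; omega, Or.inl ?_⟩
  simp only [eVert, TRel, Ne, Fin.mk.injEq, true_and]
  omega

theorem adj_eVert_succ (h : n + 2 ≤ x) (h' : x < 2 * n + 2) :
    (GEps n ε).Adj (eVert hn ε m i x) (eVert hn ε m i (x + 1)) := by
  refine ⟨by rw [Ne, eVert_inj]; omega, Or.inl ?_⟩
  simp only [eVert, TRel, Ne, Fin.mk.injEq, true_and]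
  omega

theorem adj_eVert_cVert (h : i < n) :
    (GEps n ε).Adj (eVert hn ε m i (2 * n + 2)) (cVert n ε m (i + 1)) := by
  refine ⟨cVert_ne_eVert.symm, Or.inl ?_⟩
  simp only [eVert, cVert, TRel, true_and]
  omega

theorem adj_cVert_hVert : (GEps n ε).Adj (cVert n ε m (n + 1)) (hVert hn ε m 0) := by
  refine ⟨cVert_ne_hVert, Or.inl ?_⟩
  simp only [hVert, cVert, true_and]
  omega

theorem adj_hVert_succ (h : c + 1 < n + (ε m).toNat) :
    (GEps n ε).Adj (hVert hn ε m c) (hVert hn ε m (c + 1)) := by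
  refine ⟨by rw [Ne, hVert_inj]; omega, Or.inl ?_⟩
  simp only [hVert, true_and]
  omega

theorem adj_leftExit_cVert : (GEps n ε).Adj (leftExit hn ε m) (cVert n ε m 0) := by
  refine ⟨leftExit_ne_cVert, Or.inl ?_⟩
  cases m
  · simp only [leftExit, dVert, cVert, true_and]
    omega
  · simp only [leftExit, hVert, cVert, true_and]
    omega

theorem vertex_cases (hn : 1 ≤ n) (v : GV n ε) :
    (∃ j ≤ 2 * n + 2, v = dVert n ε j) ∨ v = leftExit hn ε 0 ∨
    (∃ m, ∃ j < n + 2, v = cVert n ε m j) ∨ (∃ m, ∃ i < n, ∃ x ≤ 2 * n + 2, v = eVert hn ε m i x) ∨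
    (∃ m, ∃ c < n, v = hVert hn ε m c) ∨
    ∃ m, v = leftExit hn ε (m + 1) := by
  rcases v with ⟨j, hj⟩ | ⟨m, ⟨j, hj⟩ | ⟨⟨i, hi⟩, ⟨x, hx⟩⟩⟩ | ⟨m, c, hc⟩
  · by_cases h : j = 2 * n + 3
    · refine Or.inr (Or.inl ?_)
      simp [leftExit, dVert, h]
    · refine Or.inl ⟨j, by omega, ?_⟩
      simp only [dVert, Sum.inl.injEq, Fin.mk.injEq]; omega
  · refine Or.inr (Or.inr (Or.inl ⟨m, j, hj, ?_⟩))
    simp only [cVert, Sum.inr.injEq, Sum.inl.injEq, Fin.mk.injEq, Prod.mk.injEq, true_and]; omega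
  · refine Or.inr (Or.inr (Or.inr (Or.inl ⟨m, i, hi, x, by omega, ?_⟩)))
    simp only [eVert, Sum.inr.injEq, Sum.inl.injEq, Fin.mk.injEq, Prod.mk.injEq, true_and]; omega
  · have hb := (ε m).toNat_le
    by_cases h : c < n
    · refine Or.inr (Or.inr (Or.inr (Or.inr (Or.inl ⟨m, c, h, ?_⟩))))
      simp only [hVert, Sum.inr.injEq, Sigma.mk.injEq, heq_eq_eq, true_and, Fin.mk.injEq]; omega
    · refine Or.inr (Or.inr (Or.inr (Or.inr (Or.inr ⟨m, ?_⟩))))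
      simp only [leftExit, hVert, Sum.inr.injEq, Sigma.mk.injEq, heq_eq_eq, true_and,
        Fin.mk.injEq]
      omega

section Maximal

variable {V : Type*} {G : SimpleGraph V} {f : GEps n ε →g G}

theorem neighborClosed_dVert (hn : 1 ≤ n) (hf : Function.Injective f)
    (hG : GraphFree (Bridge n) G) (hj : j ≤ 2 * n + 2) : NeighborClosed f (dVert n ε j) := by
  have := neighborClosed_of_deadEnd hf (k := dVert n ε) (N := n + 3)
    (fun i hi j hj h => by rw [dVert_inj] at h; omega) hG hn rfl
    (fun i hi j hj h => adj_dVert hi hj h) (fun j => dVert n ε (n + 2 + j)) (a := n + 2)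
    (by omega) rfl (fun j hj h1 b hb h => by rw [dVert_inj] at h; omega)
    (fun j hj k hk h => by rw [dVert_inj] at h; omega)
    (fun j hj => adj_dVert_succ (by omega) (by omega))
  by_cases h : j < n + 3
  · exact this.1 j h
  · have := this.2 (j - (n + 2)) (by omega) (by omega)
    rwa [show n + 2 + (j - (n + 2)) = j by omega] at this

theorem neighborClosed_eVert (hn : 1 ≤ n) (hf : Function.Injective f)
    (hG : GraphFree (Bridge n) G) (hi : i < n) (hx : x ≤ 2 * n + 2) :
    NeighborClosed f (eVert hn ε m i x) := by
  set p : ℕ → GV n ε := fun j => if j ≤ n then eVert hn ε m i (n + 2 + j) else cVert n ε m (i + 1)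
    with hp
  have p1 : ∀ j ≤ n, p j = eVert hn ε m i (n + 2 + j) := fun j hj => by simp [hp, hj]
  have p2 : p (n + 1) = cVert n ε m (i + 1) := by simp [hp]
  have := neighborClosed_of_deadEnd hf (k := eVert hn ε m i) (N := n + 3)
    (fun i hi j hj h => by rw [eVert_inj] at h; omega) hG hn rfl
    (fun i hi j hj h => adj_eVert hi hj h) p (a := n + 2) (by omega) (p1 0 (by omega)) ?_ ?_ ?_
  · by_cases h : x < n + 3
    · exact this.1 x h
    · have := this.2 (x - (n + 2)) (by omega) (by omega)
      rwa [p1 _ (by omega), show n + 2 + (x - (n + 2)) = x by omega] at this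
  · intro j hj h1 b hb h
    rcases hj.lt_or_eq with h' | rfl
    · rw [p1 j (by omega), eVert_inj] at h; omega
    · rw [p2] at h; exact cVert_ne_eVert h.symm
  · intro j hj k hk h
    rcases hj.lt_or_eq with h1 | rfl <;> rcases hk.lt_or_eq with h2 | rfl
    · rw [p1 j (by omega), p1 k (by omega), eVert_inj] at h; omega
    · rw [p1 j (by omega), p2] at h; exact absurd h.symm cVert_ne_eVert
    · rw [p1 k (by omega), p2] at h; exact absurd h cVert_ne_eVert
    · rfl
  · intro j hj
    rcases hj.lt_or_eq with h1 | rfl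
    · rw [p1 j hj, p1 (j + 1) h1]; exact adj_eVert_succ (by omega) (by omega)
    · rw [p1 j le_rfl, p2, show j + 2 + j = 2 * j + 2 by omega]; exact adj_eVert_cVert hi

theorem neighborClosed_cVert (hn : 1 ≤ n) (hf : Function.Injective f)
    (hG : GraphFree (Bridge n) G) (hj : j < n + 2) : NeighborClosed f (cVert n ε m j) := by
  set o : ℕ → GV n ε := fun j => if j = 0 then leftExit hn ε m else
    if j = n + 1 then hVert hn ε m 0 else eVert hn ε m (j - 1) (2 * n + 2) with ho
  have o0 : o 0 = leftExit hn ε m := by simp [ho]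
  have on : o (n + 1) = hVert hn ε m 0 := by simp [ho]
  have oi : ∀ i < n, o (i + 1) = eVert hn ε m i (2 * n + 2) := fun i hi => by
    simp [ho, hi.ne]
  have cases : ∀ i < n + 2, i = 0 ∨ i = n + 1 ∨ ∃ j < n, i = j + 1 := by
    intro i hi
    by_cases h : i = 0 ∨ i = n + 1
    · tauto
    · exact Or.inr (Or.inr ⟨i - 1, by omega, by omega⟩)
  refine neighborClosed_of_driveThrough hf (k := cVert n ε m) (N := n + 2)
    (fun i hi j hj h => by rw [cVert_inj] at h; omega) hG hn rfl
    (fun i hi j hj h => adj_cVert hi hj h) o ?_ ?_ ?_ hj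
  · intro i hi
    rcases cases i hi with rfl | rfl | ⟨i, hi', rfl⟩
    · rw [o0]; exact adj_leftExit_cVert.symm
    · rw [on]; exact adj_cVert_hVert
    · rw [oi i hi']; exact (adj_eVert_cVert hi').symm
  · intro i hi j hj
    rcases cases i hi with rfl | rfl | ⟨i, hi', rfl⟩
    · rw [o0]; exact leftExit_ne_cVert.symm
    · rw [on]; exact cVert_ne_hVert
    · rw [oi i hi']; exact cVert_ne_eVert
  · intro i hi j hj h
    rcases cases i hi with rfl | rfl | ⟨i, hi', rfl⟩ <;>
    rcases cases j hj with rfl | rfl | ⟨j, hj', rfl⟩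
    · rfl
    · rw [o0, on] at h; exact absurd h leftExit_ne_hVert
    · rw [o0, oi j hj'] at h; exact absurd h leftExit_ne_eVert
    · rw [o0, on] at h; exact absurd h.symm leftExit_ne_hVert
    · rfl
    · rw [on, oi j hj'] at h; exact absurd h.symm eVert_ne_hVert
    · rw [o0, oi i hi'] at h; exact absurd h.symm leftExit_ne_eVert
    · rw [on, oi i hi'] at h; exact absurd h eVert_ne_hVert
    · rw [oi i hi', oi j hj', eVert_inj] at h; omega

theorem neighborClosed_of_adj_leftExit (hn : 1 ≤ n) (hf : Function.Injective f)
    (hG : GraphFree (Bridge n) G) {v : GV n ε} (hv : (GEps n ε).Adj (leftExit hn ε m) v)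
    (hvc : ∀ j, cVert n ε m j ≠ v) : NeighborClosed f (leftExit hn ε m) := by
  set s : ℕ → GV n ε := fun j =>
    if j = 0 then cVert n ε m 0 else if j = 1 then leftExit hn ε m else v with hs
  have s0 : s 0 = cVert n ε m 0 := by simp [hs]
  have s1 : s 1 = leftExit hn ε m := by simp [hs]
  have s2 : s 2 = v := by simp [hs]
  have hlc : ∀ j, cVert n ε m j ≠ leftExit hn ε m := fun j => leftExit_ne_cVert.symm
  rw [← s1]
  refine neighborClosed_of_spine hf (k := cVert n ε m) (N := n + 2)
    (fun i hi j hj h => by rw [cVert_inj] at h; omega) hG le_rfl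
    (fun i hi j hj h => adj_cVert hi hj h) (fun i hi => neighborClosed_cVert hn hf hG hi) s hn
    le_rfl (a := 0) (by omega) s0 ?_ ?_ ?_
  · intro j hj h1 b hb
    obtain rfl | rfl : j = 1 ∨ j = 2 := by omega
    · rw [s1]; exact hlc b
    · rw [s2]; exact hvc b
  · have := hv.ne
    have := hlc 0
    have := hvc 0
    intro j hj k hk h
    obtain rfl | rfl | rfl : j = 0 ∨ j = 1 ∨ j = 2 := by omega
    all_goals obtain rfl | rfl | rfl : k = 0 ∨ k = 1 ∨ k = 2 := by omega
    all_goals grind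
  · intro j hj
    obtain rfl | rfl : j = 0 ∨ j = 1 := by omega
    · rw [s0, s1]; exact adj_leftExit_cVert.symm
    · rw [s1, s2]; exact hv

theorem neighborClosed_hVert (hn : 1 ≤ n) (hf : Function.Injective f)
    (hG : GraphFree (Bridge n) G) (hc : c < n) : NeighborClosed f (hVert hn ε m c) := by
  set s : ℕ → GV n ε := fun j => if j = 0 then cVert n ε m (n + 1) else
    if j ≤ n + (ε m).toNat then hVert hn ε m (j - 1) else cVert n ε (m + 1) 0 with hs
  have s0 : s 0 = cVert n ε m (n + 1) := by simp [hs]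
  have s1 : ∀ j < n + (ε m).toNat, s (j + 1) = hVert hn ε m j := fun j hj => by
    simp [hs]; omega
  have s2 : s (n + (ε m).toNat + 1) = cVert n ε (m + 1) 0 := by simp [hs]
  have cases : ∀ j ≤ c + 2, j = 0 ∨ (∃ i < n + (ε m).toNat, j = i + 1) ∨
      j = n + (ε m).toNat + 1 := by
    intro j hj
    by_cases h : j = 0 ∨ j = n + (ε m).toNat + 1
    · tauto
    · exact Or.inr (Or.inl ⟨j - 1, by omega, by omega⟩)
  rw [← s1 c (by omega)]
  refine neighborClosed_of_spine hf (k := cVert n ε m) (N := n + 2)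
    (fun i hi j hj h => by rw [cVert_inj] at h; omega) hG le_rfl
    (fun i hi j hj h => adj_cVert hi hj h) (fun i hi => neighborClosed_cVert hn hf hG hi) s hc
    (by omega) (a := n + 1) (by omega) s0 ?_ ?_ ?_
  · intro j hj h1 b hb
    rcases cases j hj with rfl | ⟨j, hj', rfl⟩ | rfl
    · omega
    · rw [s1 j hj']; exact cVert_ne_hVert
    · rw [s2, Ne, cVert_inj]; omega
  · intro j hj k hk h
    rcases cases j hj with rfl | ⟨j, hj', rfl⟩ | rfl <;>
    rcases cases k hk with rfl | ⟨k, hk', rfl⟩ | rfl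
    · rfl
    · rw [s0, s1 k hk'] at h; exact absurd h cVert_ne_hVert
    · rw [s0, s2, cVert_inj] at h; omega
    · rw [s0, s1 j hj'] at h; exact absurd h.symm cVert_ne_hVert
    · rw [s1 j hj', s1 k hk', hVert_inj] at h; omega
    · rw [s1 j hj', s2] at h; exact absurd h.symm cVert_ne_hVert
    · rw [s0, s2, cVert_inj] at h; omega
    · rw [s1 k hk', s2] at h; exact absurd h cVert_ne_hVert
    · rfl
  · intro j hj
    rcases Nat.eq_zero_or_pos j with rfl | h0
    · rw [s0, s1 0 (by omega)]; exact adj_cVert_hVert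
    obtain ⟨j, rfl⟩ := Nat.exists_eq_add_of_le' h0
    rw [s1 j (by omega)]
    by_cases h : j + 1 < n + (ε m).toNat
    · rw [s1 (j + 1) h]; exact adj_hVert_succ h
    · obtain rfl : j = n + (ε m).toNat - 1 := by omega
      rw [show n + (ε m).toNat - 1 + 1 = n + (ε m).toNat by omega, s2]
      exact adj_leftExit_cVert (hn := hn) (m := m + 1)

theorem neighborClosed_leftExit (hn : 1 ≤ n) (hf : Function.Injective f)
    (hG : GraphFree (Bridge n) G) : NeighborClosed f (leftExit hn ε m) := by
  cases m with
  | zero =>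
    exact neighborClosed_of_adj_leftExit hn hf hG (v := dVert n ε (2 * n + 2))
      (adj_dVert_succ (by omega) (by omega)).symm fun j => dVert_ne_cVert.symm
  | succ m =>
    by_cases h : n + (ε m).toNat - 1 < n
    · exact neighborClosed_hVert hn hf hG h
    · refine neighborClosed_of_adj_leftExit hn hf hG
        (v := hVert hn ε m (n + (ε m).toNat - 2)) ?_ fun j => cVert_ne_hVert
      have := adj_hVert_succ (hn := hn) (ε := ε) (m := m) (c := n + (ε m).toNat - 2) (by omega)
      rw [show n + (ε m).toNat - 2 + 1 = n + (ε m).toNat - 1 by omega] at this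
      exact this.symm

theorem neighborClosed (hn : 1 ≤ n) (hf : Function.Injective f)
    (hG : GraphFree (Bridge n) G) (v : GV n ε) : NeighborClosed f v := by
  rcases vertex_cases hn v with ⟨j, hj, rfl⟩ | rfl | ⟨m, j, hj, rfl⟩ | ⟨m, i, hi, x, hx, rfl⟩ |
    ⟨m, c, hc, rfl⟩ | ⟨m, rfl⟩
  · exact neighborClosed_dVert hn hf hG hj
  · exact neighborClosed_leftExit hn hf hG
  · exact neighborClosed_cVert hn hf hG hj
  · exact neighborClosed_eVert hn hf hG hi hx
  · exact neighborClosed_hVert hn hf hG hc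
  · exact neighborClosed_leftExit hn hf hG

end Maximal

end GEps

/-- If `G` is a connected `B_n`-free graph and `G_ε` is a subgraph of `G` (witnessed
    by an injective graph homomorphism `f`), then `G_ε = G`: `f` is onto the vertices
    of `G` and `G` has no edges besides those of `G_ε`, i.e. `f` is an isomorphism. -/
theorem gEps_maximal (n : ℕ) (hn : 1 ≤ n) (ε : ℕ → Bool) {V : Type*}
    (G : SimpleGraph V) (hconn : G.Connected) (f : GEps n ε →g G)
    (hf : Function.Injective f) (hG : GraphFree (Bridge n) G) :
    Function.Surjective f ∧ ∀ u v, G.Adj (f u) (f v) → (GEps n ε).Adj u v := by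
  have : Nonempty (GV n ε) := ⟨GEps.dVert n ε 0⟩
  have h := GEps.neighborClosed hn hf hG
  exact ⟨surjective_of_neighborClosed hconn h, fun u _ huv => (h u).adj hf huv⟩
end

section
/- For every n ≥ 1, if ε and ν are two distinct members of 2^ω, then the graphs G_ε and G_ν are not isomorphic. -/
open SimpleGraph

/-- `f` is the distance function to the vertex set `S`, expressed by its local properties. -/
structure IsDistTo {V : Type*} (G : SimpleGraph V) (S : Set V) (f : V → ℕ) : Prop where
  eq_zero_iff : ∀ v, f v = 0 ↔ v ∈ S
  le_of_adj : ∀ u v, G.Adj u v → f u ≤ f v + 1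
  exists_adj : ∀ v, f v ≠ 0 → ∃ u, G.Adj v u ∧ f u + 1 = f v

theorem IsDistTo.le {V : Type*} {G : SimpleGraph V} {S : Set V} {f g : V → ℕ}
    (hf : IsDistTo G S f) (hg : IsDistTo G S g) (v : V) : f v ≤ g v := by
  induction hk : g v generalizing v with
  | zero => exact ((hf.eq_zero_iff v).2 ((hg.eq_zero_iff v).1 hk)).le
  | succ k ih =>
    obtain ⟨u, hu, hgu⟩ := hg.exists_adj v (by omega)
    have := ih u (by omega)
    have := hf.le_of_adj v u hu
    omega

theorem IsDistTo.comp_iso {V W : Type*} {G : SimpleGraph V} {H : SimpleGraph W} (φ : G ≃g H)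
    {S : Set W} {f : W → ℕ} (hf : IsDistTo H S f) : IsDistTo G (φ ⁻¹' S) (f ∘ φ) where
  eq_zero_iff v := hf.eq_zero_iff (φ v)
  le_of_adj u v h := hf.le_of_adj _ _ (φ.map_adj_iff.2 h)
  exists_adj v h := by
    obtain ⟨u, hu, hfu⟩ := hf.exists_adj (φ v) h
    obtain ⟨u, rfl⟩ := φ.surjective u
    exact ⟨u, φ.map_adj_iff.1 hu, hfu⟩

theorem IsDistTo.apply_iso {V W : Type*} {G : SimpleGraph V} {H : SimpleGraph W} (φ : G ≃g H)
    {S : Set V} {S' : Set W} {f : V → ℕ} {f' : W → ℕ} (hf : IsDistTo G S f)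
    (hf' : IsDistTo H S' f') (hS : ∀ v, φ v ∈ S' ↔ v ∈ S) (v : V) : f' (φ v) = f v := by
  have hS' : φ ⁻¹' S' = S := Set.ext hS
  have h := hf'.comp_iso φ
  rw [hS'] at h
  exact le_antisymm (h.le hf v) (hf.le h v)

/-- The vertex `v` lies in a triangle of `G`. -/
def InTriangle {V : Type*} (G : SimpleGraph V) (v : V) : Prop :=
  ∃ u w, G.Adj v u ∧ G.Adj v w ∧ G.Adj u w

/-- The vertices of `G` which, together with all their neighbours, lie in triangles. -/
def triangleInterior {V : Type*} (G : SimpleGraph V) : Set V :=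
  {v | InTriangle G v ∧ ∀ u, G.Adj v u → InTriangle G u}

theorem inTriangle_apply_iff {V W : Type*} {G : SimpleGraph V} {H : SimpleGraph W} (φ : G ≃g H)
    (v : V) : InTriangle H (φ v) ↔ InTriangle G v := by
  constructor
  · rintro ⟨u, w, h₁, h₂, h₃⟩
    obtain ⟨u, rfl⟩ := φ.surjective u
    obtain ⟨w, rfl⟩ := φ.surjective w
    exact ⟨u, w, φ.map_adj_iff.1 h₁, φ.map_adj_iff.1 h₂, φ.map_adj_iff.1 h₃⟩
  · rintro ⟨u, w, h₁, h₂, h₃⟩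
    exact ⟨φ u, φ w, φ.map_adj_iff.2 h₁, φ.map_adj_iff.2 h₂, φ.map_adj_iff.2 h₃⟩

theorem apply_mem_triangleInterior_iff {V W : Type*} {G : SimpleGraph V} {H : SimpleGraph W}
    (φ : G ≃g H) (v : V) : φ v ∈ triangleInterior H ↔ v ∈ triangleInterior G := by
  refine and_congr (inTriangle_apply_iff φ v) ⟨fun h u hu => ?_, fun h u hu => ?_⟩
  · exact (inTriangle_apply_iff φ u).1 (h _ (φ.map_adj_iff.2 hu))
  · obtain ⟨u, rfl⟩ := φ.surjective u
    exact (inTriangle_apply_iff φ u).2 (h _ (φ.map_adj_iff.1 hu))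

namespace GEps

variable {n : ℕ} {ε : ℕ → Bool}

/-- A vertex of the initial dead end. -/
abbrev dead (ε : ℕ → Bool) (u : Fin (2 * n + 4)) : GV n ε := .inl u

/-- A vertex of the complete graph of a drive through. -/
abbrev clique (ε : ℕ → Bool) (m : ℕ) (j : Fin (n + 2)) : GV n ε := .inr (.inl (m, .inl j))

/-- A vertex of a dead end hanging off a drive through. -/
abbrev hang (ε : ℕ → Bool) (m : ℕ) (i : Fin n) (x : Fin (2 * n + 3)) : GV n ε :=
  .inr (.inl (m, .inr (i, x)))

/-- A vertex of a connecting path. -/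
abbrev road (m : ℕ) (c : Fin (n + (ε m).toNat)) : GV n ε := .inr (.inr ⟨m, c⟩)

theorem vertex_cases_s11 {p : GV n ε → Prop} (hD : ∀ u, p (dead ε u)) (hK : ∀ m j, p (clique ε m j))
    (hP : ∀ m i x, p (hang ε m i x)) (hH : ∀ m c, p (road m c)) (v : GV n ε) : p v := by
  rcases v with u | ⟨m, j | ⟨i, x⟩⟩ | ⟨m, c⟩
  exacts [hD u, hK m j, hP m i x, hH m c]

theorem adj_dead_dead (u v : Fin (2 * n + 4)) : (GEps n ε).Adj (dead ε u) (dead ε v) ↔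
    ((u : ℕ) < n + 3 ∧ (v : ℕ) < n + 3 ∧ (u : ℕ) ≠ v) ∨
    (n + 2 ≤ (u : ℕ) ∧ (v : ℕ) = (u : ℕ) + 1) ∨ (n + 2 ≤ (v : ℕ) ∧ (u : ℕ) = (v : ℕ) + 1) := by
  simp only [GEps, fromRel_adj, ne_eq, Sum.inl.injEq, Fin.ext_iff]
  omega

theorem adj_dead_clique (u : Fin (2 * n + 4)) (m : ℕ) (j : Fin (n + 2)) :
    (GEps n ε).Adj (dead ε u) (clique ε m j) ↔ (u : ℕ) = 2 * n + 3 ∧ m = 0 ∧ (j : ℕ) = 0 := by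
  simp [GEps]

theorem not_adj_dead_hang (u : Fin (2 * n + 4)) (m : ℕ) (i : Fin n) (x : Fin (2 * n + 3)) :
    ¬ (GEps n ε).Adj (dead ε u) (hang ε m i x) := by
  simp [GEps]

theorem not_adj_dead_road (u : Fin (2 * n + 4)) (m : ℕ) (c : Fin (n + (ε m).toNat)) :
    ¬ (GEps n ε).Adj (dead ε u) (road m c) := by
  simp [GEps]

theorem adj_clique_clique (m m' : ℕ) (j j' : Fin (n + 2)) :
    (GEps n ε).Adj (clique ε m j) (clique ε m' j') ↔ m = m' ∧ (j : ℕ) ≠ j' := by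
  simp only [GEps, TRel, fromRel_adj, ne_eq, Sum.inl.injEq, Sum.inr.injEq, Prod.mk.injEq,
    Fin.ext_iff]
  omega

theorem adj_clique_hang (m m' : ℕ) (j : Fin (n + 2)) (i : Fin n) (x : Fin (2 * n + 3)) :
    (GEps n ε).Adj (clique ε m j) (hang ε m' i x) ↔
      m = m' ∧ (x : ℕ) = 2 * n + 2 ∧ (j : ℕ) = i + 1 := by
  simp [GEps, TRel, eq_comm]

theorem adj_clique_road (m m' : ℕ) (j : Fin (n + 2)) (c : Fin (n + (ε m').toNat)) :
    (GEps n ε).Adj (clique ε m j) (road m' c) ↔ ((j : ℕ) = n + 1 ∧ m' = m ∧ (c : ℕ) = 0) ∨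
      ((c : ℕ) = n + (ε m').toNat - 1 ∧ m = m' + 1 ∧ (j : ℕ) = 0) := by
  simp [GEps]

theorem adj_hang_hang (m m' : ℕ) (i i' : Fin n) (x y : Fin (2 * n + 3)) :
    (GEps n ε).Adj (hang ε m i x) (hang ε m' i' y) ↔ m = m' ∧ (i : ℕ) = i' ∧
    (((x : ℕ) < n + 3 ∧ (y : ℕ) < n + 3 ∧ (x : ℕ) ≠ y) ∨
    (n + 2 ≤ (x : ℕ) ∧ (y : ℕ) = (x : ℕ) + 1) ∨ (n + 2 ≤ (y : ℕ) ∧ (x : ℕ) = (y : ℕ) + 1)) := by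
  simp only [GEps, TRel, fromRel_adj, ne_eq, Sum.inr.injEq, Sum.inl.injEq, Prod.mk.injEq,
    Fin.ext_iff]
  omega

theorem not_adj_hang_road (m m' : ℕ) (i : Fin n) (x : Fin (2 * n + 3))
    (c : Fin (n + (ε m').toNat)) : ¬ (GEps n ε).Adj (hang ε m i x) (road m' c) := by
  simp [GEps]

theorem adj_road_road (m m' : ℕ) (c : Fin (n + (ε m).toNat)) (c' : Fin (n + (ε m').toNat)) :
    (GEps n ε).Adj (road m c) (road m' c') ↔
      m = m' ∧ ((c' : ℕ) = c + 1 ∨ (c : ℕ) = c' + 1) := by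
  simp only [GEps, fromRel_adj, ne_eq, Sum.inr.injEq]
  constructor
  · omega
  · rintro ⟨rfl, h⟩
    refine ⟨fun h' => ?_, by omega⟩
    simp only [Sigma.mk.injEq, heq_eq_eq, true_and, Fin.ext_iff] at h'
    omega

theorem adj_clique_dead (u : Fin (2 * n + 4)) (m : ℕ) (j : Fin (n + 2)) :
    (GEps n ε).Adj (clique ε m j) (dead ε u) ↔ (u : ℕ) = 2 * n + 3 ∧ m = 0 ∧ (j : ℕ) = 0 := by
  rw [adj_comm, adj_dead_clique]

theorem not_adj_hang_dead (u : Fin (2 * n + 4)) (m : ℕ) (i : Fin n) (x : Fin (2 * n + 3)) :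
    ¬ (GEps n ε).Adj (hang ε m i x) (dead ε u) := by
  rw [adj_comm]; exact not_adj_dead_hang u m i x

theorem not_adj_road_dead (u : Fin (2 * n + 4)) (m : ℕ) (c : Fin (n + (ε m).toNat)) :
    ¬ (GEps n ε).Adj (road m c) (dead ε u) := by
  rw [adj_comm]; exact not_adj_dead_road u m c

theorem adj_hang_clique (m m' : ℕ) (j : Fin (n + 2)) (i : Fin n) (x : Fin (2 * n + 3)) :
    (GEps n ε).Adj (hang ε m' i x) (clique ε m j) ↔
      m = m' ∧ (x : ℕ) = 2 * n + 2 ∧ (j : ℕ) = i + 1 := by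
  rw [adj_comm, adj_clique_hang]

theorem adj_road_clique (m m' : ℕ) (j : Fin (n + 2)) (c : Fin (n + (ε m').toNat)) :
    (GEps n ε).Adj (road m' c) (clique ε m j) ↔ ((j : ℕ) = n + 1 ∧ m' = m ∧ (c : ℕ) = 0) ∨
      ((c : ℕ) = n + (ε m').toNat - 1 ∧ m = m' + 1 ∧ (j : ℕ) = 0) := by
  rw [adj_comm, adj_clique_road]

theorem not_adj_road_hang (m m' : ℕ) (i : Fin n) (x : Fin (2 * n + 3))
    (c : Fin (n + (ε m').toNat)) : ¬ (GEps n ε).Adj (road m' c) (hang ε m i x) := by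
  rw [adj_comm]; exact not_adj_hang_road m m' i x c

/-- The vertices of `GEps n ε` lying on one of its large complete subgraphs. -/
def InClique : GV n ε → Prop
  | .inl u => (u : ℕ) < n + 3
  | .inr (.inl (_, .inl _)) => True
  | .inr (.inl (_, .inr (_, x))) => (x : ℕ) < n + 3
  | .inr (.inr _) => False

/-- The distance to the vertices of dead ends all of whose neighbours lie in cliques. -/
def depth : GV n ε → ℕ
  | .inl u => u - (n + 1)
  | .inr (.inl (_, .inl j)) => if (j : ℕ) = 0 ∨ (j : ℕ) = n + 1 then n + 3 else n + 2
  | .inr (.inl (_, .inr (_, x))) => x - (n + 1)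
  | .inr (.inr ⟨m, c⟩) => n + 4 + min (c : ℕ) (n + (ε m).toNat - 1 - c)

/-- The distance from the first left exit to the first vertex of the `m`-th drive through. -/
def entry (n : ℕ) (ε : ℕ → Bool) : ℕ → ℕ
  | 0 => 1
  | m + 1 => entry n ε m + (n + 2 + (ε m).toNat)

theorem entry_strictMono : StrictMono (entry n ε) :=
  strictMono_nat_of_lt_succ fun m => by rw [entry]; omega

theorem entry_pos (m : ℕ) : 0 < entry n ε m :=
  Nat.one_pos.trans_le (entry_strictMono.monotone m.zero_le)

/-- The distance to the first left exit. -/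
def height : GV n ε → ℕ
  | .inl u => if (u : ℕ) < n + 2 then n + 2 else 2 * n + 3 - u
  | .inr (.inl (m, .inl j)) => entry n ε m + if (j : ℕ) = 0 then 0 else 1
  | .inr (.inl (m, .inr (_, x))) =>
      entry n ε m + 1 + if (x : ℕ) < n + 2 then n + 2 else 2 * n + 3 - x
  | .inr (.inr ⟨m, c⟩) => entry n ε m + 2 + c

theorem inTriangle_iff (hn : 1 ≤ n) (v : GV n ε) : InTriangle (GEps n ε) v ↔ InClique v := by
  constructor
  · rintro ⟨u, w, h₁, h₂, h₃⟩
    induction v using vertex_cases_s11 <;> induction u using vertex_cases_s11 <;>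
      induction w using vertex_cases_s11 <;>
      simp only [adj_dead_dead, adj_dead_clique, not_adj_dead_hang, not_adj_dead_road,
        adj_clique_clique, adj_clique_hang, adj_clique_road, adj_hang_hang, not_adj_hang_road,
        adj_road_road, adj_clique_dead, not_adj_hang_dead, not_adj_road_dead, adj_hang_clique,
        adj_road_clique, not_adj_road_hang, InClique] at h₁ h₂ h₃ ⊢ <;> grind
  · intro h
    have aux (u : ℕ) : ∃ a b : ℕ, a < 3 ∧ b < 3 ∧ a ≠ b ∧ u ≠ a ∧ u ≠ b := by
      rcases u with _ | _ | u
      exacts [⟨1, 2, by omega⟩, ⟨0, 2, by omega⟩, ⟨0, 1, by omega⟩]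
    induction v using vertex_cases_s11 with
    | hD u =>
      simp only [InClique] at h
      obtain ⟨a, b, ha, hb, hab, hua, hub⟩ := aux u
      refine ⟨dead ε ⟨a, by omega⟩, dead ε ⟨b, by omega⟩, ?_⟩
      simp only [adj_dead_dead]
      omega
    | hK m j =>
      obtain ⟨a, b, ha, hb, hab, hja, hjb⟩ := aux j
      refine ⟨clique ε m ⟨a, by omega⟩, clique ε m ⟨b, by omega⟩, ?_⟩
      simp only [adj_clique_clique, true_and]
      omega
    | hP m i x =>
      simp only [InClique] at h
      obtain ⟨a, b, ha, hb, hab, hxa, hxb⟩ := aux x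
      refine ⟨hang ε m i ⟨a, by omega⟩, hang ε m i ⟨b, by omega⟩, ?_⟩
      simp only [adj_hang_hang, true_and]
      omega
    | hH m c => exact h.elim

theorem mem_triangleInterior_iff (hn : 1 ≤ n) (v : GV n ε) :
    v ∈ triangleInterior (GEps n ε) ↔ depth v = 0 := by
  simp only [triangleInterior, Set.mem_ofPred_eq, inTriangle_iff hn]
  constructor
  · rintro ⟨h, h'⟩
    induction v using vertex_cases_s11 with
    | hD u =>
      by_contra hu
      simp only [InClique, depth] at h hu
      have := h' (dead ε ⟨n + 3, by omega⟩) ((adj_dead_dead _ _).2 (by grind))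
      simp [InClique] at this
    | hK m j =>
      exfalso
      rcases Nat.eq_zero_or_pos (j : ℕ) with hj | hj
      · rcases m with _ | m
        · have := h' (dead ε ⟨2 * n + 3, by omega⟩) ((adj_clique_dead _ _ _).2 ⟨rfl, rfl, hj⟩)
          simp only [InClique] at this
          omega
        · exact h' (road m ⟨n + (ε m).toNat - 1, by omega⟩)
            ((adj_clique_road _ _ _ _).2 (.inr ⟨rfl, rfl, hj⟩))
      · by_cases hj' : (j : ℕ) = n + 1
        · exact h' (road m ⟨0, by omega⟩) ((adj_clique_road _ _ _ _).2 (.inl ⟨hj', rfl, rfl⟩))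
        · have := h' (hang ε m ⟨j - 1, by omega⟩ ⟨2 * n + 2, by omega⟩)
            ((adj_clique_hang _ _ _ _ _).2 ⟨rfl, rfl, by simp; omega⟩)
          simp only [InClique] at this
          omega
    | hP m i x =>
      by_contra hu
      simp only [InClique, depth] at h hu
      have := h' (hang ε m i ⟨n + 3, by omega⟩) ((adj_hang_hang _ _ _ _ _ _).2 (by grind))
      simp [InClique] at this
    | hH m c => exact h.elim
  · intro h
    refine ⟨?_, fun u hu => ?_⟩
    · induction v using vertex_cases_s11 <;> simp only [depth, InClique] at h ⊢ <;> grind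
    · induction v using vertex_cases_s11 <;> induction u using vertex_cases_s11 <;>
        simp only [adj_dead_dead, adj_dead_clique, not_adj_dead_hang, not_adj_dead_road,
          adj_hang_hang, not_adj_hang_road, not_adj_hang_dead, adj_hang_clique, InClique, depth]
          at h hu ⊢ <;> grind

theorem isDistTo_depth (hn : 1 ≤ n) :
    IsDistTo (GEps n ε) (triangleInterior (GEps n ε)) depth where
  eq_zero_iff v := (mem_triangleInterior_iff hn v).symm
  le_of_adj u v h := by
    induction v using vertex_cases_s11 <;> induction u using vertex_cases_s11 <;>
      simp only [adj_dead_dead, adj_dead_clique, not_adj_dead_hang, not_adj_dead_road,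
        adj_clique_clique, adj_clique_hang, adj_clique_road, adj_hang_hang, not_adj_hang_road,
        adj_road_road, adj_clique_dead, not_adj_hang_dead, not_adj_road_dead, adj_hang_clique,
        adj_road_clique, not_adj_road_hang, depth] at h ⊢ <;> grind
  exists_adj v h := by
    induction v using vertex_cases_s11 with
    | hD u =>
      simp only [depth] at h
      exact ⟨dead ε ⟨u - 1, by omega⟩, (adj_dead_dead _ _).2 (by grind), by grind [depth]⟩
    | hK m j =>
      by_cases hj : (j : ℕ) = 0 ∨ (j : ℕ) = n + 1
      · exact ⟨clique ε m ⟨1, by omega⟩, (adj_clique_clique _ _ _ _).2 (by grind), by grind [depth]⟩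
      · exact ⟨hang ε m ⟨j - 1, by omega⟩ ⟨2 * n + 2, by omega⟩,
          (adj_clique_hang _ _ _ _ _).2 (by grind), by grind [depth]⟩
    | hP m i x =>
      simp only [depth] at h
      exact ⟨hang ε m i ⟨x - 1, by omega⟩, (adj_hang_hang _ _ _ _ _ _).2 (by grind),
        by grind [depth]⟩
    | hH m c =>
      by_cases hc : (c : ℕ) ≤ n + (ε m).toNat - 1 - c
      · by_cases hc₀ : (c : ℕ) = 0
        · exact ⟨clique ε m ⟨n + 1, by omega⟩, (adj_road_clique _ _ _ _).2 (.inl ⟨rfl, rfl, hc₀⟩),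
            by grind [depth]⟩
        · exact ⟨road m ⟨c - 1, by omega⟩, (adj_road_road _ _ _ _).2 (by grind), by grind [depth]⟩
      · by_cases hc₁ : (c : ℕ) = n + (ε m).toNat - 1
        · exact ⟨clique ε (m + 1) ⟨0, by omega⟩,
            (adj_road_clique _ _ _ _).2 (.inr ⟨hc₁, rfl, rfl⟩), by grind [depth]⟩
        · exact ⟨road m ⟨c + 1, by omega⟩, (adj_road_road _ _ _ _).2 (by grind), by grind [depth]⟩

theorem isDistTo_height (hn : 1 ≤ n) :
    IsDistTo (GEps n ε) {v | ¬ InTriangle (GEps n ε) v ∧ depth v = n + 2} height where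
  eq_zero_iff v := by
    rw [Set.mem_ofPred_eq, inTriangle_iff hn]
    induction v using vertex_cases_s11 <;> simp only [InClique, depth, height] <;>
      grind [entry_pos]
  le_of_adj u v h := by
    induction v using vertex_cases_s11 <;> induction u using vertex_cases_s11 <;>
      simp only [adj_dead_dead, adj_dead_clique, not_adj_dead_hang, not_adj_dead_road,
        adj_clique_clique, adj_clique_hang, adj_clique_road, adj_hang_hang, not_adj_hang_road,
        adj_road_road, adj_clique_dead, not_adj_hang_dead, not_adj_road_dead, adj_hang_clique,
        adj_road_clique, not_adj_road_hang, height] at h ⊢ <;> grind [entry]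
  exists_adj v h := by
    induction v using vertex_cases_s11 with
    | hD u =>
      simp only [height] at h
      by_cases hu : (u : ℕ) < n + 2
      · exact ⟨dead ε ⟨n + 2, by omega⟩, (adj_dead_dead _ _).2 (by grind), by grind [height]⟩
      · exact ⟨dead ε ⟨u + 1, by grind⟩, (adj_dead_dead _ _).2 (by grind), by grind [height]⟩
    | hK m j =>
      by_cases hj : (j : ℕ) = 0
      · rcases m with _ | m
        · exact ⟨dead ε ⟨2 * n + 3, by omega⟩, (adj_clique_dead _ _ _).2 ⟨rfl, rfl, hj⟩,
            by grind [height, entry]⟩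
        · exact ⟨road m ⟨n + (ε m).toNat - 1, by omega⟩,
            (adj_clique_road _ _ _ _).2 (.inr ⟨rfl, rfl, hj⟩), by grind [height, entry]⟩
      · exact ⟨clique ε m ⟨0, by omega⟩, (adj_clique_clique _ _ _ _).2 (by grind),
          by grind [height]⟩
    | hP m i x =>
      by_cases hx : (x : ℕ) < n + 2
      · exact ⟨hang ε m i ⟨n + 2, by omega⟩, (adj_hang_hang _ _ _ _ _ _).2 (by grind),
          by grind [height]⟩
      · by_cases hx' : (x : ℕ) = 2 * n + 2
        · exact ⟨clique ε m ⟨i + 1, by omega⟩, (adj_hang_clique _ _ _ _ _).2 (by grind),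
            by grind [height]⟩
        · exact ⟨hang ε m i ⟨x + 1, by omega⟩, (adj_hang_hang _ _ _ _ _ _).2 (by grind),
            by grind [height]⟩
    | hH m c =>
      by_cases hc : (c : ℕ) = 0
      · exact ⟨clique ε m ⟨n + 1, by omega⟩, (adj_road_clique _ _ _ _).2 (.inl ⟨rfl, rfl, hc⟩),
          by grind [height]⟩
      · exact ⟨road m ⟨c - 1, by omega⟩, (adj_road_road _ _ _ _).2 (by grind), by grind [height]⟩

theorem exists_height_eq_iff (hn : 1 ≤ n) (k : ℕ) :
    (∃ v : GV n ε, InTriangle (GEps n ε) v ∧ depth v = n + 3 ∧ height v = k) ↔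
      ∃ m, k = entry n ε m ∨ k = entry n ε m + 1 := by
  simp only [inTriangle_iff hn]
  constructor
  · rintro ⟨v, h, hd, rfl⟩
    induction v using vertex_cases_s11 with
    | hK m j =>
      refine ⟨m, ?_⟩
      simp only [height]
      split_ifs <;> simp
    | _ => simp only [InClique, depth] at h hd; try omega
  · rintro ⟨m, rfl | rfl⟩
    · exact ⟨clique ε m 0, trivial, by simp [depth], by simp [height]⟩
    · exact ⟨clique ε m (Fin.last _), trivial, by simp [depth], by simp [height]⟩

theorem entry_succ_le {ν : ℕ → Bool} {m : ℕ} (h : entry n ε m = entry n ν m)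
    (hS : ∃ j, entry n ε (m + 1) = entry n ν j ∨ entry n ε (m + 1) = entry n ν j + 1) :
    entry n ν (m + 1) ≤ entry n ε (m + 1) := by
  obtain ⟨j, hj⟩ := hS
  have hlt : m < j := by
    by_contra! hjm
    have := (entry_strictMono (n := n) (ε := ν)).monotone hjm
    rw [entry] at hj
    omega
  have := (entry_strictMono (n := n) (ε := ν)).monotone hlt
  simp only [Nat.succ_eq_add_one] at this
  omega

theorem entry_injective : Function.Injective (entry n) := by
  intro ε ν h
  funext m
  have h₁ := congrFun h (m + 1)
  rw [entry, entry, congrFun h m] at h₁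
  have : (ε m).toNat = (ν m).toNat := by omega
  cases hε : ε m <;> cases hν : ν m <;> simp_all

theorem eq_of_iso (hn : 1 ≤ n) {ν : ℕ → Bool} (φ : GEps n ε ≃g GEps n ν) : ε = ν := by
  have hd := (isDistTo_depth hn).apply_iso φ (isDistTo_depth hn)
    (apply_mem_triangleInterior_iff φ)
  have hh := (isDistTo_height hn).apply_iso φ (isDistTo_height hn) fun v => by
    simp only [Set.mem_ofPred_eq, inTriangle_apply_iff φ, hd]
  have hS : ∀ k, (∃ m, k = entry n ε m ∨ k = entry n ε m + 1) ↔
      ∃ m, k = entry n ν m ∨ k = entry n ν m + 1 := by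
    intro k
    rw [← exists_height_eq_iff hn, ← exists_height_eq_iff hn, φ.surjective.exists]
    simp only [inTriangle_apply_iff φ, hd, hh]
  apply entry_injective (n := n)
  funext m
  induction m with
  | zero => rfl
  | succ m ih =>
    exact le_antisymm (entry_succ_le ih.symm ((hS _).2 ⟨_, .inl rfl⟩))
      (entry_succ_le ih ((hS _).1 ⟨_, .inl rfl⟩))

end GEps

/-- For every `n ≥ 1`, if `ε ≠ ν` are two members of `2^ω`, then the graphs `G_ε`
    and `G_ν` are not isomorphic. -/
theorem gEps_not_isomorphic (n : ℕ) (hn : 1 ≤ n) (ε ν : ℕ → Bool) (hεν : ε ≠ ν) :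
    IsEmpty (GEps n ε ≃g GEps n ν) := by
  exact ⟨fun φ => hεν (GEps.eq_of_iso hn φ)⟩
end

section
/- For k ≥ 2, if f_1 and f_2 are two embeddings of the graph S_k into a graph G that omits all cycles of length at most 2k, and f_1(x_i) = f_2(x_i) for all i ∈ ℤ_5, then f_1 = f_2. -/
open SimpleGraph

/-- `G` omits all cycles of length at most `2k`:
    every cycle in `G` has length greater than `2k`. -/
def NoShortCycles (k : ℕ) {V : Type*} (G : SimpleGraph V) : Prop :=
  ∀ (v : V) (c : G.Walk v v), c.IsCycle → 2 * k < c.length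

/-- Vertex set of `S_k`: `Sum.inl i` is the distinguished vertex `xᵢ` (`i ∈ ℤ₅`), and
    `Sum.inr (i, j)` is the inner vertex `y_{i,j+1}` of the path from `xᵢ` to `xᵢ₊₁`. -/
abbrev SV (k : ℕ) := Fin 5 ⊕ (Fin 5 × Fin (k - 1))

/-- The graph `S_k`: a pentagon on `x₀,…,x₄` each of whose edges is subdivided into a
    simple path `xᵢ, y_{i,1},…,y_{i,k-1}, xᵢ₊₁` of length `k` (indices in `ℤ₅`). -/
def Pentagon (k : ℕ) : SimpleGraph (SV k) :=
  SimpleGraph.fromRel (fun a b =>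
    match a, b with
    | .inl i, .inr (i', j) => (i' = i ∧ (j : ℕ) = 0) ∨ (i' + 1 = i ∧ (j : ℕ) = k - 2)
    | .inr (i, j), .inr (i', j') => i = i' ∧ (j' : ℕ) = (j : ℕ) + 1
    | _, _ => False)

/-- In a graph without cycles of length at most `2k`, two paths with the same ends and total
length at most `2k` coincide. -/
theorem NoShortCycles.path_unique {k : ℕ} {V : Type*} {G : SimpleGraph V}
    (hG : NoShortCycles k G) {u v : V} {p q : G.Walk u v} (hp : p.IsPath) (hq : q.IsPath)
    (hl : p.length + q.length ≤ 2 * k) : p = q := by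
  classical
  let s : Finset (Sym2 V) := (p.edges ++ q.edges).toFinset
  let H : SimpleGraph V := fromEdgeSet (s : Set (Sym2 V))
  have mem_H : ∀ e, e ∈ H.edgeSet ↔ e ∈ s ∧ ¬ e.IsDiag := fun e => by simp [H]
  have hHG : H ≤ G := by
    rw [← edgeSet_subset_edgeSet]
    intro e he
    rcases List.mem_append.1 (List.mem_toFinset.1 ((mem_H e).1 he).1) with h | h
    · exact p.edges_subset_edgeSet h
    · exact q.edges_subset_edgeSet h
  have hpH : ∀ e ∈ p.edges, e ∈ H.edgeSet := fun e he => (mem_H e).2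
    ⟨List.mem_toFinset.2 (List.mem_append_left _ he),
      G.not_isDiag_of_mem_edgeSet (p.edges_subset_edgeSet he)⟩
  have hqH : ∀ e ∈ q.edges, e ∈ H.edgeSet := fun e he => (mem_H e).2
    ⟨List.mem_toFinset.2 (List.mem_append_right _ he),
      G.not_isDiag_of_mem_edgeSet (q.edges_subset_edgeSet he)⟩
  have hH : H.IsAcyclic := by
    intro w c hc
    have hlt := hG w (c.mapLe hHG) (hc.mapLe hHG)
    have hsub : c.edges.toFinset ⊆ s := fun e he =>
      ((mem_H e).1 (c.edges_subset_edgeSet (List.mem_toFinset.1 he))).1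
    have hcard := Finset.card_le_card hsub
    rw [List.toFinset_card_of_nodup hc.edges_nodup, Walk.length_edges] at hcard
    have hs : s.card ≤ p.length + q.length := by
      have := List.toFinset_card_le (p.edges ++ q.edges)
      rwa [List.length_append, Walk.length_edges, Walk.length_edges] at this
    rw [Walk.mapLe, Walk.length_map] at hlt
    omega
  have h := (hH.subsingleton_path u v).elim ⟨p.transfer H hpH, hp.transfer hpH⟩
    ⟨q.transfer H hqH, hq.transfer hqH⟩
  have h' := congrArg Walk.support (congrArg Subtype.val h)
  simp only [Walk.support_transfer] at h'
  exact Walk.ext_support h'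

/-- A sequence of successively adjacent vertices is the support of a walk. -/
theorem exists_walk_support_eq_map_range {V : Type*} {G : SimpleGraph V} (n : ℕ) (u : ℕ → V)
    (hu : ∀ j < n, G.Adj (u j) (u (j + 1))) :
    ∃ p : G.Walk (u 0) (u n), p.support = (List.range (n + 1)).map u := by
  induction n with
  | zero => exact ⟨.nil, by simp⟩
  | succ n ih =>
    obtain ⟨p, hp⟩ := ih fun j hj => hu j (by omega)
    refine ⟨p.concat (hu n (by omega)), ?_⟩
    rw [Walk.support_concat, hp, List.range_succ (n := n + 1)]
    simp

/-- In a graph without cycles of length at most `2k`, two injective sequences of `k + 1`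
successively adjacent vertices with the same ends coincide. -/
theorem NoShortCycles.seq_unique {k : ℕ} {V : Type*} {G : SimpleGraph V}
    (hG : NoShortCycles k G) {u v : ℕ → V} (hu : ∀ j < k, G.Adj (u j) (u (j + 1)))
    (hv : ∀ j < k, G.Adj (v j) (v (j + 1))) (hui : Set.InjOn u (Set.Iic k))
    (hvi : Set.InjOn v (Set.Iic k)) (h0 : u 0 = v 0) (hk : u k = v k) {j : ℕ} (hj : j ≤ k) :
    u j = v j := by
  have isPath : ∀ (w : ℕ → V) {a b : V} (r : G.Walk a b), Set.InjOn w (Set.Iic k) →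
      r.support = (List.range (k + 1)).map w → r.IsPath ∧ r.length = k := by
    intro w a b r hw hr
    refine ⟨Walk.IsPath.mk' ?_, ?_⟩
    · rw [hr]
      refine List.Nodup.map_on ?_ List.nodup_range
      intro x hx y hy hxy
      simp only [List.mem_range] at hx hy
      exact hw (Set.mem_Iic.2 (by omega)) (Set.mem_Iic.2 (by omega)) hxy
    · have := congrArg List.length hr
      simpa using this
  obtain ⟨p, hp⟩ := exists_walk_support_eq_map_range k u hu
  obtain ⟨q, hq⟩ := exists_walk_support_eq_map_range k v hv
  have hq' : (q.copy h0.symm hk.symm).support = (List.range (k + 1)).map v := by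
    rw [Walk.support_copy, hq]
  obtain ⟨hpp, hpl⟩ := isPath u p hui hp
  obtain ⟨hqp, hql⟩ := isPath v _ hvi hq'
  have h := congrArg Walk.support (hG.path_unique hpp hqp (by omega))
  rw [hp, hq'] at h
  exact List.map_inj_left.1 h j (List.mem_range.2 (by omega))

/-- The vertices of the subdivided edge of `S_k` from `xᵢ` to `xᵢ₊₁`, in order. -/
def sideVertex (k : ℕ) (i : Fin 5) (j : ℕ) : SV k :=
  if j = 0 then .inl i
  else if h : j - 1 < k - 1 then .inr (i, ⟨j - 1, h⟩)
  else .inl (i + 1)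

theorem sideVertex_adj {k : ℕ} (hk : 2 ≤ k) (i : Fin 5) {j : ℕ} (hj : j < k) :
    (Pentagon k).Adj (sideVertex k i j) (sideVertex k i (j + 1)) := by
  rcases Nat.eq_zero_or_pos j with rfl | hj0
  · have h : 0 < k - 1 := by omega
    simp [Pentagon, sideVertex, h]
  · have h : j - 1 < k - 1 := by omega
    by_cases h' : j < k - 1
    · simp [Pentagon, sideVertex, h, h', hj0.ne']
      omega
    · simp [Pentagon, sideVertex, h, h', hj0.ne']
      omega

theorem sideVertex_injOn (k : ℕ) (i : Fin 5) : Set.InjOn (sideVertex k i) (Set.Iic k) := by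
  have hi : i ≠ i + 1 := by revert i; decide
  intro a ha b hb hab
  simp only [Set.mem_Iic] at ha hb
  unfold sideVertex at hab
  split_ifs at hab <;> simp_all <;> omega

/-- If `f₁` and `f₂` are two embeddings (injective graph homomorphisms) of `S_k` into a
    graph `G` omitting all cycles of length at most `2k` (`k ≥ 2`), and `f₁(xᵢ) = f₂(xᵢ)`
    for all `i ∈ ℤ₅`, then `f₁ = f₂`. -/
theorem pentagon_rigid (k : ℕ) (hk : 2 ≤ k) {V : Type*} (G : SimpleGraph V)
    (hG : NoShortCycles k G) (f₁ f₂ : Pentagon k →g G)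
    (h₁ : Function.Injective f₁) (h₂ : Function.Injective f₂)
    (hx : ∀ i : Fin 5, f₁ (Sum.inl i) = f₂ (Sum.inl i)) : f₁ = f₂ := by
  have side : ∀ (i : Fin 5) {j : ℕ}, j ≤ k → f₁ (sideVertex k i j) = f₂ (sideVertex k i j) := by
    intro i j hj
    refine hG.seq_unique (u := fun j => f₁ (sideVertex k i j))
      (v := fun j => f₂ (sideVertex k i j))
      (fun j hj => f₁.map_adj (sideVertex_adj hk i hj))
      (fun j hj => f₂.map_adj (sideVertex_adj hk i hj))
      (h₁.comp_injOn (sideVertex_injOn k i)) (h₂.comp_injOn (sideVertex_injOn k i)) ?_ ?_ hj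
    · simpa [sideVertex] using hx i
    · have hk0 : k ≠ 0 := by omega
      simpa [sideVertex, hk0] using hx (i + 1)
  ext a
  rcases a with i | ⟨i, j⟩
  · exact hx i
  · simpa [sideVertex] using side i (j := j + 1) (by omega)
end
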